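/- Fix integers N ≥ 1, p ≥ 1 and a real β, and set θ = tanh β. The map γ ↦ A_N(γ,β) = (1/N) Σ_{k=0}^∞ e^{−γN}(γN)^k/k! · N^{−pk} Σ_{I:{1,…,k}→{1,…,N}^p} ln Z_N(I,β) is differentiable for γ > 0, and dA_N(γ,β)/dγ = ln cosh β + Σ_{k=0}^∞ e^{−γN}(γN)^k/k! · N^{−pk} Σ_{I:{1,…,k}→{1,…,N}^p} [ N^{−p} Σ_{(i_1,…,i_p)∈{1,…,N}^p} ln(1 + θ ω_I(σ_{i_1}⋯σ_{i_p})) ]. -/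

import Mathlib

open scoped BigOperators

noncomputable section

/-- The value of a Boolean spin: `true ↦ 1`, `false ↦ -1`. -/
def spin (b : Bool) : ℝ := if b then 1 else -1

/-- Poisson probability mass function with mean `c`. -/
def poisProb (c : ℝ) (k : ℕ) : ℝ := Real.exp (-c) * c ^ k / (Nat.factorial k)

/-- Diluted p-spin energy (minus the Hamiltonian) for an index family `I`. -/
def energy (N p k : ℕ) (I : Fin k → Fin p → Fin N) (σ : Fin N → Bool) : ℝ :=
  ∑ ν : Fin k, ∏ j : Fin p, spin (σ (I ν j))

/-- Diluted p-spin partition function `Z_N(I, β)`. -/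
def Zdil (N p k : ℕ) (β : ℝ) (I : Fin k → Fin p → Fin N) : ℝ :=
  ∑ σ : Fin N → Bool, Real.exp (β * energy N p k I σ)

/-- Boltzmann state `ω_I(g)` of the diluted p-spin system. -/
def gibbsAvgI (N p k : ℕ) (β : ℝ) (I : Fin k → Fin p → Fin N)
    (g : (Fin N → Bool) → ℝ) : ℝ :=
  (∑ σ : Fin N → Bool, g σ * Real.exp (β * energy N p k I σ)) / Zdil N p k β I

/-- Finite-volume quenched pressure `A_N(γ, β)`. -/
def pressure (N p : ℕ) (β γ : ℝ) : ℝ :=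
  (1 / (N : ℝ)) * ∑' k : ℕ, poisProb (γ * N) k * ((N : ℝ) ^ (p * k))⁻¹ *
    ∑ I : Fin k → Fin p → Fin N, Real.log (Zdil N p k β I)

/-- An exponentially bounded sequence has summable exponential-series coefficients. -/
lemma summable_pow_div_factorial_mul {f : ℕ → ℝ} {C r : ℝ} (hf : ∀ k, |f k| ≤ C * r ^ k)
    (c : ℝ) : Summable fun k : ℕ => c ^ k / (Nat.factorial k) * f k := by
  refine Summable.of_norm_bounded ((Real.summable_pow_div_factorial (|c| * r)).mul_left C) ?_
  intro k
  rw [Real.norm_eq_abs, abs_mul, abs_div, abs_pow, Nat.abs_cast, mul_pow]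
  calc |c| ^ k / (Nat.factorial k) * |f k|
      ≤ |c| ^ k / (Nat.factorial k) * (C * r ^ k) := by gcongr; exact hf k
    _ = C * (|c| ^ k * r ^ k / (Nat.factorial k)) := by ring

/-- Termwise differentiation of an exponential generating function. -/
lemma hasDerivAt_tsum_pow_div_factorial_mul {f : ℕ → ℝ} {C r : ℝ}
    (hf : ∀ k, |f k| ≤ C * r ^ k) (c : ℝ) :
    HasDerivAt (fun x : ℝ => ∑' k : ℕ, x ^ k / (Nat.factorial k) * f k)
      (∑' k : ℕ, c ^ k / (Nat.factorial k) * f (k + 1)) c := by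
  set R : ℝ := |c| + 1 with hR
  have hRpos : 0 < R := by positivity
  have hshift : ∀ k, |f (k + 1)| ≤ (C * r) * r ^ k := fun k =>
    (hf (k + 1)).trans_eq (by ring)
  have hcoeff : ∀ (x : ℝ) (k : ℕ), ((k + 1 : ℕ) : ℝ) * x ^ (k + 1 - 1) /
      (Nat.factorial (k + 1)) * f (k + 1) = x ^ k / (Nat.factorial k) * f (k + 1) := by
    intro x k
    rw [Nat.factorial_succ]
    push_cast
    field_simp
  have hsum : ∀ x : ℝ, Summable fun k : ℕ => (k : ℝ) * x ^ (k - 1) / (Nat.factorial k) * f k := by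
    intro x
    rw [← summable_nat_add_iff 1]
    simp only [hcoeff]
    exact summable_pow_div_factorial_mul hshift x
  have hmem : c ∈ Metric.ball (0 : ℝ) R := by simp [hR]
  have h := hasDerivAt_tsum_of_isPreconnected (hsum R).norm Metric.isOpen_ball
    (convex_ball (0 : ℝ) R).isPreconnected
    (g := fun (k : ℕ) (x : ℝ) => x ^ k / (Nat.factorial k) * f k)
    (g' := fun (k : ℕ) (x : ℝ) => (k : ℝ) * x ^ (k - 1) / (Nat.factorial k) * f k)
    (fun k x _ => ((hasDerivAt_pow k x).div_const _).mul_const _)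
    (fun k x hx => by
      have hxR : |x| ≤ R := by simpa using (Metric.mem_ball.mp hx).le
      simp only [Real.norm_eq_abs, abs_mul, abs_div, abs_pow, Nat.abs_cast, abs_of_pos hRpos]
      gcongr)
    hmem (summable_pow_div_factorial_mul hf c) hmem
  refine h.congr_deriv ?_
  rw [(hsum c).tsum_eq_zero_add]
  simp only [hcoeff]
  simp

lemma summable_poisProb_mul {f : ℕ → ℝ} {C r : ℝ} (hf : ∀ k, |f k| ≤ C * r ^ k) (c : ℝ) :
    Summable fun k : ℕ => poisProb c k * f k := by
  refine ((summable_pow_div_factorial_mul hf c).mul_left (Real.exp (-c))).congr fun k => ?_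
  rw [poisProb]
  ring

lemma hasSum_poisProb (c : ℝ) : HasSum (poisProb c) 1 := by
  have h := (NormedSpace.expSeries_div_hasSum_exp c).mul_left (Real.exp (-c))
  rw [← Real.exp_eq_exp_ℝ, ← Real.exp_add, neg_add_cancel, Real.exp_zero] at h
  refine h.congr_fun fun k => ?_
  rw [poisProb]
  ring

/-- The derivative of a Poisson average in its mean is the average of the forward difference. -/
lemma hasDerivAt_tsum_poisProb_mul {f : ℕ → ℝ} {C r : ℝ} (hf : ∀ k, |f k| ≤ C * r ^ k)
    (c : ℝ) :
    HasDerivAt (fun x : ℝ => ∑' k : ℕ, poisProb x k * f k)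
      (∑' k : ℕ, poisProb c k * (f (k + 1) - f k)) c := by
  have hshift : ∀ k, |f (k + 1)| ≤ (C * r) * r ^ k := fun k =>
    (hf (k + 1)).trans_eq (by ring)
  have hfactor : ∀ (x : ℝ) (g : ℕ → ℝ), ∑' k : ℕ, poisProb x k * g k =
      Real.exp (-x) * ∑' k : ℕ, x ^ k / (Nat.factorial k) * g k := by
    intro x g
    rw [← tsum_mul_left]
    exact tsum_congr fun k => by rw [poisProb]; ring
  have hexp : HasDerivAt (fun x : ℝ => Real.exp (-x)) (-Real.exp (-c)) c := by
    simpa using (hasDerivAt_neg c).exp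
  have h := hexp.mul (hasDerivAt_tsum_pow_div_factorial_mul hf c)
  simp only [hfactor]
  refine h.congr_deriv ?_
  simp only [mul_sub]
  rw [(summable_pow_div_factorial_mul hshift c).tsum_sub (summable_pow_div_factorial_mul hf c)]
  ring

lemma spin_eq_one_or_neg_one (b : Bool) : spin b = 1 ∨ spin b = -1 := by
  cases b <;> simp [spin]

lemma prod_spin_eq_one_or_neg_one {α : Type*} (s : Finset α) (b : α → Bool) :
    ∏ j ∈ s, spin (b j) = 1 ∨ ∏ j ∈ s, spin (b j) = -1 := by
  refine Finset.prod_induction _ (fun x : ℝ => x = 1 ∨ x = -1) ?_ (Or.inl rfl)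
    fun j _ => spin_eq_one_or_neg_one (b j)
  rintro x y (rfl | rfl) (rfl | rfl) <;> simp

lemma exp_mul_prod_spin (β : ℝ) {α : Type*} (s : Finset α) (b : α → Bool) :
    Real.exp (β * ∏ j ∈ s, spin (b j)) =
      Real.cosh β * (1 + Real.tanh β * ∏ j ∈ s, spin (b j)) := by
  have hc := (Real.cosh_pos β).ne'
  rw [Real.tanh_eq_sinh_div_cosh]
  rcases prod_spin_eq_one_or_neg_one s b with h | h <;> rw [h]
  · rw [mul_one, ← Real.cosh_add_sinh]
    field_simp
  · rw [mul_neg_one, ← Real.cosh_sub_sinh]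
    field_simp
    ring

lemma abs_energy_le (N p k : ℕ) (I : Fin k → Fin p → Fin N) (σ : Fin N → Bool) :
    |energy N p k I σ| ≤ k := by
  refine (Finset.abs_sum_le_sum_abs _ _).trans ?_
  refine (Finset.sum_le_card_nsmul _ _ 1 fun ν _ => ?_).trans (by simp)
  rcases prod_spin_eq_one_or_neg_one Finset.univ (fun j => σ (I ν j)) with h | h <;> simp [h]

lemma energy_cons (N p k : ℕ) (ι : Fin p → Fin N) (I : Fin k → Fin p → Fin N)
    (σ : Fin N → Bool) :
    energy N p (k + 1) (Fin.cons ι I) σ = ∏ j : Fin p, spin (σ (ι j)) + energy N p k I σ := by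
  simp [energy, Fin.sum_univ_succ]

lemma Zdil_pos (N p k : ℕ) (β : ℝ) (I : Fin k → Fin p → Fin N) : 0 < Zdil N p k β I :=
  Finset.sum_pos (fun _ _ => Real.exp_pos _) Finset.univ_nonempty

lemma Zdil_cons (N p k : ℕ) (β : ℝ) (ι : Fin p → Fin N) (I : Fin k → Fin p → Fin N) :
    Zdil N p (k + 1) β (Fin.cons ι I) = Real.cosh β * Zdil N p k β I *
      (1 + Real.tanh β * gibbsAvgI N p k β I (fun σ => ∏ j : Fin p, spin (σ (ι j)))) := by
  have hZ := (Zdil_pos N p k β I).ne'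
  have h : Zdil N p (k + 1) β (Fin.cons ι I) = Real.cosh β * (Zdil N p k β I + Real.tanh β *
      ∑ σ : Fin N → Bool, (∏ j : Fin p, spin (σ (ι j))) * Real.exp (β * energy N p k I σ)) := by
    simp only [Zdil]
    rw [Finset.mul_sum, ← Finset.sum_add_distrib, Finset.mul_sum]
    refine Finset.sum_congr rfl fun σ _ => ?_
    rw [energy_cons, mul_add, Real.exp_add, exp_mul_prod_spin]
    ring
  rw [h, gibbsAvgI]
  field_simp

lemma log_Zdil_cons (N p k : ℕ) (β : ℝ) (ι : Fin p → Fin N) (I : Fin k → Fin p → Fin N) :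
    Real.log (Zdil N p (k + 1) β (Fin.cons ι I)) =
      Real.log (Real.cosh β) + Real.log (Zdil N p k β I) +
      Real.log (1 + Real.tanh β *
        gibbsAvgI N p k β I (fun σ => ∏ j : Fin p, spin (σ (ι j)))) := by
  have hc := (Real.cosh_pos β).ne'
  have hZ := (Zdil_pos N p k β I).ne'
  have h := (Zdil_pos N p (k + 1) β (Fin.cons ι I)).ne'
  rw [Zdil_cons] at h ⊢
  rw [Real.log_mul (mul_ne_zero hc hZ) (right_ne_zero_of_mul h), Real.log_mul hc hZ]

lemma abs_log_Zdil_le (N p k : ℕ) (β : ℝ) (I : Fin k → Fin p → Fin N) :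
    |Real.log (Zdil N p k β I)| ≤ N * Real.log 2 + |β| * k := by
  have hE : ∀ σ, |β * energy N p k I σ| ≤ |β| * k := fun σ => by
    rw [abs_mul]
    exact mul_le_mul_of_nonneg_left (abs_energy_le N p k I σ) (abs_nonneg β)
  have hN : 0 ≤ N * Real.log 2 := by positivity
  rw [abs_le]
  constructor
  · rw [Real.le_log_iff_exp_le (Zdil_pos N p k β I)]
    calc Real.exp (-(N * Real.log 2 + |β| * k))
        ≤ Real.exp (β * energy N p k I fun _ => true) :=
          Real.exp_le_exp.mpr (by linarith [(abs_le.mp (hE fun _ => true)).1])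
      _ ≤ Zdil N p k β I :=
          Finset.single_le_sum (f := fun σ => Real.exp (β * energy N p k I σ))
            (fun σ _ => (Real.exp_pos _).le) (Finset.mem_univ _)
  · rw [Real.log_le_iff_le_exp (Zdil_pos N p k β I), Real.exp_add, ← Real.log_pow,
      Real.exp_log (by positivity)]
    refine (Finset.sum_le_card_nsmul _ _ (Real.exp (|β| * k)) fun σ _ =>
      Real.exp_le_exp.mpr ((le_abs_self _).trans (hE σ))).trans (by simp)

/-- The average of `log Z` over index families with exactly `k` terms. -/
def meanLogZdil (N p : ℕ) (β : ℝ) (k : ℕ) : ℝ :=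
  ((N : ℝ) ^ (p * k))⁻¹ * ∑ I : Fin k → Fin p → Fin N, Real.log (Zdil N p k β I)

lemma inv_pow_mul_sum_const (N p k : ℕ) (hN : 1 ≤ N) (a : ℝ) :
    ((N : ℝ) ^ (p * k))⁻¹ * ∑ _I : Fin k → Fin p → Fin N, a = a := by
  have h : (N : ℝ) ≠ 0 := by positivity
  simp [pow_mul, h]

lemma abs_meanLogZdil_le (N p : ℕ) (hN : 1 ≤ N) (β : ℝ) (k : ℕ) :
    |meanLogZdil N p β k| ≤ (N * Real.log 2 + |β|) * 2 ^ k := by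
  have hk : (k : ℝ) ≤ 2 ^ k := by exact_mod_cast Nat.lt_two_pow_self.le
  have h1 : (1 : ℝ) ≤ 2 ^ k := one_le_pow₀ one_le_two
  have hL : 0 ≤ N * Real.log 2 := by positivity
  calc |meanLogZdil N p β k|
      ≤ ((N : ℝ) ^ (p * k))⁻¹ *
          ∑ _I : Fin k → Fin p → Fin N, (N * Real.log 2 + |β| * k) := by
        rw [meanLogZdil, abs_mul, abs_of_nonneg (by positivity)]
        gcongr
        exact (Finset.abs_sum_le_sum_abs _ _).trans
          (Finset.sum_le_sum fun I _ => abs_log_Zdil_le N p k β I)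
    _ = N * Real.log 2 + |β| * k := inv_pow_mul_sum_const N p k hN _
    _ ≤ (N * Real.log 2 + |β|) * 2 ^ k := by
        nlinarith [mul_le_mul_of_nonneg_left hk (abs_nonneg β), mul_le_mul_of_nonneg_left h1 hL]

lemma meanLogZdil_succ_sub (N p : ℕ) (hN : 1 ≤ N) (β : ℝ) (k : ℕ) :
    meanLogZdil N p β (k + 1) - meanLogZdil N p β k = Real.log (Real.cosh β) +
      ((N : ℝ) ^ (p * k))⁻¹ * ∑ I : Fin k → Fin p → Fin N,
        ((N : ℝ) ^ p)⁻¹ * ∑ ι : Fin p → Fin N,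
          Real.log (1 + Real.tanh β *
            gibbsAvgI N p k β I (fun σ => ∏ j : Fin p, spin (σ (ι j)))) := by
  have hN0 : (N : ℝ) ≠ 0 := by positivity
  have hsplit : ∑ I : Fin (k + 1) → Fin p → Fin N, Real.log (Zdil N p (k + 1) β I) =
      ∑ I : Fin k → Fin p → Fin N, ∑ ι : Fin p → Fin N,
        Real.log (Zdil N p (k + 1) β (Fin.cons ι I)) := by
    rw [Finset.sum_comm, ← Fintype.sum_prod_type']
    exact (Equiv.sum_comp (Fin.consEquiv fun _ : Fin (k + 1) => Fin p → Fin N) _).symm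
  have hmean : meanLogZdil N p β (k + 1) = ((N : ℝ) ^ (p * k))⁻¹ *
      ∑ I : Fin k → Fin p → Fin N, ((N : ℝ) ^ p)⁻¹ * ∑ ι : Fin p → Fin N,
        Real.log (Zdil N p (k + 1) β (Fin.cons ι I)) := by
    rw [meanLogZdil, hsplit, ← Finset.mul_sum, mul_add, pow_add, mul_one, mul_inv, mul_assoc]
  have hinner : ∀ I : Fin k → Fin p → Fin N, ((N : ℝ) ^ p)⁻¹ * ∑ ι : Fin p → Fin N,
        Real.log (Zdil N p (k + 1) β (Fin.cons ι I)) =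
      Real.log (Real.cosh β) + Real.log (Zdil N p k β I) +
        ((N : ℝ) ^ p)⁻¹ * ∑ ι : Fin p → Fin N, Real.log (1 + Real.tanh β *
          gibbsAvgI N p k β I (fun σ => ∏ j : Fin p, spin (σ (ι j)))) := by
    intro I
    simp only [log_Zdil_cons]
    rw [Finset.sum_add_distrib, mul_add]
    simp only [Finset.sum_add_distrib, Finset.sum_const, Finset.card_univ, Fintype.card_fun,
      Fintype.card_fin, nsmul_eq_mul, Nat.cast_pow]
    field_simp
  rw [hmean]
  simp only [hinner]
  rw [Finset.sum_add_distrib, Finset.sum_add_distrib, mul_add, mul_add,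
    inv_pow_mul_sum_const N p k hN, meanLogZdil]
  ring

/-- **Connectivity derivative of the finite-volume quenched pressure**:
`dA_N/dγ = ln cosh β + E[N^{-p} Σ_{(i₁,…,i_p)} ln(1 + θ ω_I(σ_{i₁}⋯σ_{i_p}))]`. -/
theorem pressure_deriv_gamma (N p : ℕ) (hN : 1 ≤ N) (hp : 1 ≤ p)
    (β : ℝ) (γ : ℝ) (hγ : 0 < γ) :
    HasDerivAt (fun g : ℝ => pressure N p β g)
      (Real.log (Real.cosh β) +
        ∑' k : ℕ, poisProb (γ * N) k * ((N : ℝ) ^ (p * k))⁻¹ *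
          ∑ I : Fin k → Fin p → Fin N,
            ((N : ℝ) ^ p)⁻¹ * ∑ ι : Fin p → Fin N,
              Real.log (1 + Real.tanh β *
                gibbsAvgI N p k β I (fun σ => ∏ j : Fin p, spin (σ (ι j)))))
      γ := by
  have hN0 : (N : ℝ) ≠ 0 := by positivity
  have hf := abs_meanLogZdil_le N p hN β
  have hshift : ∀ k, |meanLogZdil N p β (k + 1)| ≤ ((N * Real.log 2 + |β|) * 2) * 2 ^ k :=
    fun k => (hf (k + 1)).trans_eq (by ring)
  have hsum : Summable fun k : ℕ =>
      poisProb (γ * N) k * (meanLogZdil N p β (k + 1) - meanLogZdil N p β k) := by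
    simpa only [mul_sub] using
      (summable_poisProb_mul hshift (γ * N)).sub (summable_poisProb_mul hf (γ * N))
  have hlin : HasDerivAt (fun g : ℝ => g * (N : ℝ)) N γ := by
    simpa using (hasDerivAt_id γ).mul_const (N : ℝ)
  have h := ((hasDerivAt_tsum_poisProb_mul hf (γ * N)).comp γ hlin).const_mul (1 / (N : ℝ))
  have hpressure : (fun g : ℝ => pressure N p β g) = fun g : ℝ =>
      1 / (N : ℝ) * ((fun x : ℝ => ∑' k : ℕ, poisProb x k * meanLogZdil N p β k) ∘
        fun g : ℝ => g * (N : ℝ)) g := by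
    funext g
    simp only [pressure, meanLogZdil, Function.comp_apply, mul_assoc]
  rw [hpressure]
  refine h.congr_deriv ?_
  have hlog := (hasSum_poisProb (γ * N)).mul_right (Real.log (Real.cosh β))
  have htsum := hsum.tsum_sub hlog.summable
  rw [hlog.tsum_eq] at htsum
  rw [← mul_assoc, mul_comm (1 / (N : ℝ)), mul_assoc, one_div_mul_cancel hN0, mul_one,
    ← sub_eq_iff_eq_add']
  rw [one_mul] at htsum
  rw [← htsum]
  refine tsum_congr fun k => ?_
  rw [meanLogZdil_succ_sub N p hN β k]
  ring
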